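/- arXiv:1905.12917 — 2 statements merged into one kernel-verified Lean document; each statement's English description precedes it below -/
import Mathlib

section
/- Let X be a countable type and n a natural number. If f : (Fin n → X) → ℝ is permutation invariant, i.e. f(x ∘ σ) = f(x) for every permutation σ of Fin n and every x : Fin n → X, then there exist functions φ : X → ℝ and ρ : ℝ → ℝ such that f(x) = ρ(∑_{i ∈ Fin n} φ(x i)) for all x : Fin n → X. -/
/-- Two finite families with the same multiset of values differ by a permutation of the indices. -/
theorem exists_perm_of_map_univ_eq {ι α : Type*} [Fintype ι] {a b : ι → α}
    (h : Finset.univ.val.map a = Finset.univ.val.map b) :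
    ∃ σ : Equiv.Perm ι, a = b ∘ σ := by
  classical
  have hcard : ∀ c, Fintype.card {i // a i = c} = Fintype.card {i // b i = c} := fun c => by
    have hc := congrArg (Multiset.count c) h
    simp only [Multiset.count_map, eq_comm (a := c)] at hc
    rw [Fintype.card_subtype, Fintype.card_subtype]
    exact hc
  let e : ∀ c, {i // a i = c} ≃ {i // b i = c} := fun c => Fintype.equivOfCardEq (hcard c)
  exact ⟨Equiv.ofFiberEquiv e, funext fun i => (Equiv.ofFiberEquiv_map e i).symm⟩

/-- A finite product of primes determines the family of primes up to a permutation. -/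
theorem exists_perm_of_prod_eq_of_prime {ι : Type*} [Fintype ι] {a b : ι → ℕ}
    (ha : ∀ i, (a i).Prime) (hb : ∀ i, (b i).Prime) (h : ∏ i, a i = ∏ i, b i) :
    ∃ σ : Equiv.Perm ι, a = b ∘ σ := by
  have key : Finset.univ.val.map a = Finset.univ.val.map b := by
    refine Multiset.rel_eq.mp ?_
    rw [← associated_eq_eq]
    refine UniqueFactorizationMonoid.factors_unique ?_ ?_ (Associated.of_eq h)
    · exact Multiset.forall_mem_map_iff.mpr fun i _ => ha i
    · exact Multiset.forall_mem_map_iff.mpr fun i _ => hb i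
  exact exists_perm_of_map_univ_eq key

/-- On a countable type some real-valued function has the property that its sum over a finite
family determines the family up to a permutation. -/
theorem exists_sum_eq_imp_exists_perm (X : Type*) [Countable X] :
    ∃ φ : X → ℝ, ∀ {ι : Type} [Fintype ι] (x y : ι → X),
      ∑ i, φ (x i) = ∑ i, φ (y i) → ∃ σ : Equiv.Perm ι, x = y ∘ σ := by
  obtain ⟨e, he⟩ := exists_injective_nat X
  let p : X → ℕ := fun x => Nat.nth Nat.Prime (e x)
  have hp : ∀ x, (p x).Prime := fun x => Nat.prime_nth_prime (e x)
  have hp_inj : Function.Injective p :=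
    (Nat.nth_injective Nat.infinite_setOfPred_prime).comp he
  refine ⟨fun x => Real.log (p x), fun {ι} _ x y hxy => ?_⟩
  have hpos : ∀ z : ι → X, (0 : ℝ) < ∏ i, (p (z i) : ℝ) := fun z =>
    Finset.prod_pos fun i _ => Nat.cast_pos.mpr (hp (z i)).pos
  have hlog : ∀ z : ι → X, ∑ i, Real.log (p (z i)) = Real.log (∏ i, (p (z i) : ℝ)) := fun z =>
    (Real.log_prod fun i _ => Nat.cast_ne_zero.mpr (hp (z i)).ne_zero).symm
  rw [hlog, hlog] at hxy
  have hprod : ∏ i, p (x i) = ∏ i, p (y i) := by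
    exact_mod_cast Real.log_injOn_pos (hpos x) (hpos y) hxy
  obtain ⟨σ, hσ⟩ := exists_perm_of_prod_eq_of_prime (fun i => hp (x i)) (fun i => hp (y i)) hprod
  exact ⟨σ, funext fun i => hp_inj (congrFun hσ i)⟩

/-- **DeepSets theorem, 'only if' direction** (countable domain, fixed input size).
Every permutation-invariant `f : (Fin n → X) → ℝ` decomposes as
`f x = ρ (∑ i, φ (x i))`. -/
theorem deepsets_perm_invariant_sum_decomposition
    {X : Type*} [Countable X] (n : ℕ) (f : (Fin n → X) → ℝ)
    (hf : ∀ (σ : Equiv.Perm (Fin n)) (x : Fin n → X), f (x ∘ σ) = f x) :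
    ∃ (φ : X → ℝ) (ρ : ℝ → ℝ), ∀ x : Fin n → X, f x = ρ (∑ i, φ (x i)) := by
  obtain ⟨φ, hφ⟩ := exists_sum_eq_imp_exists_perm X
  have hfac : f.FactorsThrough fun x : Fin n → X => ∑ i, φ (x i) := fun x y hxy => by
    obtain ⟨σ, rfl⟩ := hφ x y hxy
    exact hf σ y
  exact ⟨φ, Function.extend _ f 0, fun x => (hfac.extend_apply 0 x).symm⟩
end

section
/- Let X be a countable type and n a natural number. Then there exists a function φ : X → ℝ such that the map sending a multiset s over X of cardinality n to the sum ∑_{x ∈ s} φ(x) (counted with multiplicity) is injective on multisets of cardinality n; that is, for all multisets s, t over X with card s = n and card t = n, if ∑_{x ∈ s} φ(x) = ∑_{x ∈ t} φ(x) then s = t. -/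
open Polynomial in
theorem Multiset.coeff_sum_map_X_pow {R : Type*} [Semiring R] (s : Multiset ℕ) (k : ℕ) :
    ((s.map fun i => (X : R[X]) ^ i).sum).coeff k = s.count k := by
  induction s using Multiset.induction_on with
  | empty => simp
  | cons a s ih =>
    simp only [Multiset.map_cons, Multiset.sum_cons, coeff_add, ih, coeff_X_pow,
      Multiset.count_cons]
    split_ifs <;> simp [add_comm]

/-- Powers of a transcendental element have distinct sums over distinct multisets of exponents. -/
theorem Transcendental.sum_map_pow_injective {R A : Type*} [CommRing R] [CharZero R] [CommRing A]
    [Algebra R A] {r : A} (hr : Transcendental R r) :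
    Function.Injective fun s : Multiset ℕ => (s.map fun i => r ^ i).sum := by
  intro s t hst
  have h : (s.map fun i => (Polynomial.X : Polynomial R) ^ i).sum =
      (t.map fun i => (Polynomial.X : Polynomial R) ^ i).sum := by
    apply transcendental_iff_injective.1 hr
    simpa [map_multiset_sum, Multiset.map_map, Function.comp_def] using hst
  ext k
  simpa only [Multiset.coeff_sum_map_X_pow, Nat.cast_inj] using
    congrArg (fun p => p.coeff k) h

/-- **DeepSets embedding lemma.** For countable `X` there is `φ : X → ℝ` such that
summing `φ` over a multiset of cardinality `n` is injective on such multisets. -/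
theorem deepsets_multiset_sum_embedding
    {X : Type*} [Countable X] (n : ℕ) :
    ∃ φ : X → ℝ, ∀ s t : Multiset X, Multiset.card s = n → Multiset.card t = n →
      (s.map φ).sum = (t.map φ).sum → s = t := by
  obtain ⟨e, he⟩ := exists_injective_nat X
  have hr : Transcendental ℤ (liouvilleNumber (2 : ℕ)) := transcendental_liouvilleNumber le_rfl
  refine ⟨fun x => liouvilleNumber (2 : ℕ) ^ e x, fun s t _ _ h => ?_⟩
  apply Multiset.map_injective he
  apply hr.sum_map_pow_injective
  simpa only [Multiset.map_map, Function.comp_def] using h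
end
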